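/- arXiv:1103.3363 — 2 statements merged into one kernel-verified Lean document; each statement's English description precedes it below -/
import Mathlib

section
/- Let $k$ be a finite field of characteristic different from $2$, let $n \geq 1$, and let $F = (F_1, \ldots, F_n)$ be a polynomial endomorphism of $k^n$ with $\deg(F_i) \leq 2$ for all $i$. Suppose that the determinant of the Jacobian matrix of $F$ is nonzero when evaluated at every point $a \in k^n$. Then the induced map $F : k^n \to k^n$ is bijective. -/
open MvPolynomial

theorem Finsupp.exists_eq_single_one_add {σ : Type*} {s : σ →₀ ℕ} (hs : s ≠ 0) :
    ∃ (i : σ) (t : σ →₀ ℕ), s = Finsupp.single i 1 + t := by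
  obtain ⟨i, hi⟩ := Finsupp.ne_iff.1 hs
  have h : Finsupp.single i 1 ≤ s := Finsupp.single_le_iff.2 (Nat.one_le_iff_ne_zero.2 hi)
  exact ⟨i, s - Finsupp.single i 1, (add_tsub_cancel_of_le h).symm⟩

/-- A monomial exponent of degree at most two is that of `1`, `X i` or `X i * X j`. -/
theorem Finsupp.eq_of_degree_le_two {σ : Type*} {s : σ →₀ ℕ} (hs : s.degree ≤ 2) :
    s = 0 ∨ (∃ i, s = Finsupp.single i 1) ∨
      ∃ i j, s = Finsupp.single i 1 + Finsupp.single j 1 := by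
  by_cases h0 : s = 0
  · exact .inl h0
  obtain ⟨i, t, rfl⟩ := Finsupp.exists_eq_single_one_add h0
  by_cases h1 : t = 0
  · exact .inr (.inl ⟨i, by simp [h1]⟩)
  obtain ⟨j, u, rfl⟩ := Finsupp.exists_eq_single_one_add h1
  have hu : u = 0 := by
    rw [map_add, map_add, Finsupp.degree_single, Finsupp.degree_single] at hs
    exact (Finsupp.degree_eq_zero_iff u).1 (by omega)
  exact .inr (.inr ⟨i, j, by simp [hu]⟩)

/-- The midpoint formula: the symmetric difference of a polynomial of degree at most two about `c`
is given exactly by its derivative at `c`. -/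
theorem MvPolynomial.eval_add_sub_eval_sub_of_totalDegree_le_two {R σ : Type*} [CommRing R]
    [Fintype σ] {p : MvPolynomial σ R} (hp : p.totalDegree ≤ 2) (c d : σ → R) :
    eval (c + d) p - eval (c - d) p = 2 * ∑ j, eval c (pderiv j p) * d j := by
  classical
  have monomial_case (s : σ →₀ ℕ) (r : R) (hs : s.degree ≤ 2) :
      eval (c + d) (monomial s r) - eval (c - d) (monomial s r) =
        2 * ∑ j, eval c (pderiv j (monomial s r)) * d j := by
    obtain rfl | ⟨i, rfl⟩ | ⟨i, j, rfl⟩ := Finsupp.eq_of_degree_le_two hs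
    · simp
    · rw [← C_mul_X_eq_monomial]
      simp [pderiv_X, Pi.single_apply, apply_ite (eval c)]
      ring
    · have h : monomial (Finsupp.single i 1 + Finsupp.single j 1) r = C r * (X i * X j) := by
        simp [X, C_mul_monomial, monomial_mul]
      rw [h]
      simp [pderiv_X, Pi.single_apply, apply_ite (eval c), add_mul, mul_add,
        Finset.sum_add_distrib]
      ring
  rw [p.as_sum]
  simp only [map_sum, Finset.sum_mul]
  rw [Finset.sum_comm, Finset.mul_sum, ← Finset.sum_sub_distrib]
  exact Finset.sum_congr rfl fun s hs ↦ monomial_case s _ ((le_totalDegree hs).trans hp)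

theorem degree_two_nowhere_vanishing_jacobian_bijective
    {k : Type*} [Field k] [Fintype k] (hchar : ringChar k ≠ 2) (n : ℕ) (hn : 1 ≤ n)
    (F : Fin n → MvPolynomial (Fin n) k)
    (hdeg : ∀ i, (F i).totalDegree ≤ 2)
    (hjac : ∀ a : Fin n → k,
      eval a (Matrix.det (Matrix.of fun i j => pderiv j (F i))) ≠ 0) :
    Function.Bijective (fun a : Fin n → k => fun i => eval a (F i)) := by
  have h2 : (2 : k) ≠ 0 := Ring.two_ne_zero hchar
  refine Finite.injective_iff_bijective.1 fun a b hab ↦ ?_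
  let c : Fin n → k := fun i ↦ (a i + b i) / 2
  let d : Fin n → k := fun i ↦ (a i - b i) / 2
  have hcd : c + d = a := by ext i; simp only [c, d, Pi.add_apply]; field_simp; ring
  have hcd' : c - d = b := by ext i; simp only [c, d, Pi.sub_apply]; field_simp; ring
  have hdet : ((eval c).mapMatrix (Matrix.of fun i j => pderiv j (F i))).det ≠ 0 := by
    rw [← RingHom.map_det]
    exact hjac c
  have hd : d = 0 := by
    refine Matrix.eq_zero_of_mulVec_eq_zero hdet (funext fun i ↦ ?_)
    have h := eval_add_sub_eval_sub_of_totalDegree_le_two (hdeg i) c d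
    rw [hcd, hcd', sub_eq_zero.2 (congrFun hab i)] at h
    exact (mul_eq_zero.1 h.symm).resolve_left h2
  rw [← hcd, ← hcd', hd, add_zero, sub_zero]
end

section
/- Let $k$ be a field of characteristic zero and let $P, Q \in k[X]$ be univariate polynomials. Let $F = (P(X_1), X_2, X_3)$ and $G = (Q(X_1), X_2, X_3)$ as polynomial endomorphisms of $k^3$. Suppose $F$ and $G$ are equivalent, i.e., there exist polynomial automorphisms $S, T$ of $k^3$ with $S \circ F = G \circ T$. Then $P$ and $Q$ are equivalent as univariate polynomials: there exist $a, b, c, d \in k$ with $a \neq 0$ and $c \neq 0$ such that $Q(aX + b) = c \cdot P(X) + d$ in $k[X]$. -/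
open MvPolynomial

/-- Composition of polynomial endomorphisms: `(endoComp F G) i = F i (G 1, …, G n)`. -/
noncomputable def endoComp {k : Type*} [Field k] {n : ℕ}
    (F G : Fin n → MvPolynomial (Fin n) k) : Fin n → MvPolynomial (Fin n) k :=
  fun i => aeval G (F i)

/-- A polynomial endomorphism is an automorphism if it has a two-sided compositional
inverse. -/
def IsPolyAut {k : Type*} [Field k] {n : ℕ}
    (F : Fin n → MvPolynomial (Fin n) k) : Prop :=
  ∃ G : Fin n → MvPolynomial (Fin n) k,
    (∀ i, aeval G (F i) = X i) ∧ (∀ i, aeval F (G i) = X i)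

/-- The chain rule for a derivation applied to a polynomial expression. -/
theorem derivation_aeval_eq_sum {k A σ : Type*} [CommRing k] [CommRing A] [Algebra k A]
    [Fintype σ] (D : Derivation k A A) (g : σ → A) (f : MvPolynomial σ k) :
    D (aeval g f) = ∑ i, aeval g (pderiv i f) * D (g i) := by
  classical
  induction f using MvPolynomial.induction_on with
  | C a => simp
  | add p q hp hq => simp [hp, hq, add_mul, Finset.sum_add_distrib]
  | mul_X p j hp =>
    simp only [map_mul, aeval_X, Derivation.leibniz, smul_eq_mul, map_add, hp, pderiv_X,
      add_mul, Finset.sum_add_distrib, Finset.mul_sum]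
    congr 1
    · rw [Finset.sum_eq_single j]
      · simp
      · intro i _ hij
        simp [hij.symm]
      · simp
    · exact Finset.sum_congr rfl fun i _ => by ring

/-- The Jacobian matrix of a polynomial endomorphism. -/
noncomputable def jacobianMatrix {k : Type*} [Field k] {n : ℕ}
    (F : Fin n → MvPolynomial (Fin n) k) : Matrix (Fin n) (Fin n) (MvPolynomial (Fin n) k) :=
  Matrix.of fun i j => pderiv j (F i)

theorem jacobianMatrix_endoComp {k : Type*} [Field k] {n : ℕ}
    (F G : Fin n → MvPolynomial (Fin n) k) :
    jacobianMatrix (endoComp F G) = (aeval G).mapMatrix (jacobianMatrix F) * jacobianMatrix G := by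
  ext1 i j
  exact derivation_aeval_eq_sum (pderiv j) G (F i)

theorem det_jacobianMatrix_endoComp {k : Type*} [Field k] {n : ℕ}
    (F G : Fin n → MvPolynomial (Fin n) k) :
    (jacobianMatrix (endoComp F G)).det =
      aeval G (jacobianMatrix F).det * (jacobianMatrix G).det := by
  rw [jacobianMatrix_endoComp, Matrix.det_mul, AlgHom.map_det]

theorem jacobianMatrix_X {k : Type*} [Field k] {n : ℕ} :
    jacobianMatrix (X : Fin n → MvPolynomial (Fin n) k) = 1 := by
  ext1 i j
  simp [jacobianMatrix, pderiv_X, Matrix.one_apply, Pi.single_apply]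

theorem IsPolyAut.isUnit_det_jacobianMatrix {k : Type*} [Field k] {n : ℕ}
    {F : Fin n → MvPolynomial (Fin n) k} (hF : IsPolyAut F) :
    IsUnit (jacobianMatrix F).det := by
  obtain ⟨G, -, hG⟩ := hF
  have h : endoComp G F = X := funext hG
  have hdet := det_jacobianMatrix_endoComp G F
  rw [h, jacobianMatrix_X, Matrix.det_one] at hdet
  exact IsUnit.of_mul_eq_one_right _ hdet.symm

theorem IsPolyAut.aeval_injective {k : Type*} [Field k] {n : ℕ}
    {F : Fin n → MvPolynomial (Fin n) k} (hF : IsPolyAut F) :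
    Function.Injective (aeval F : MvPolynomial (Fin n) k →ₐ[k] MvPolynomial (Fin n) k) := by
  obtain ⟨G, hG, -⟩ := hF
  have h : (aeval G).comp (aeval F) = AlgHom.id k (MvPolynomial (Fin n) k) := by
    ext1 i
    rw [AlgHom.comp_apply, aeval_X, hG, AlgHom.id_apply]
  intro p q hpq
  simpa only [← AlgHom.comp_apply, h, AlgHom.id_apply] using congrArg (aeval G) hpq

theorem det_jacobianMatrix_polynomial {k : Type*} [Field k] (P : Polynomial k) :
    (jacobianMatrix ![Polynomial.aeval (X 0 : MvPolynomial (Fin 3) k) P, X 1, X 2]).det =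
      Polynomial.aeval (X 0 : MvPolynomial (Fin 3) k) P.derivative := by
  simp [jacobianMatrix, Matrix.det_fin_three, pderiv_X]

theorem exists_eq_add_C_of_derivative_eq {k : Type*} [Field k] [CharZero k]
    {p q : Polynomial k} (h : p.derivative = q.derivative) :
    ∃ d : k, p = q + Polynomial.C d := by
  have h0 : (p - q).derivative = 0 := by simp [h]
  obtain ⟨d, hd⟩ := Polynomial.natDegree_eq_zero.1
    (Polynomial.derivative_eq_zero.1 h0)
  exact ⟨d, by rw [hd]; ring⟩

/-- Restriction of polynomials in three variables to the first coordinate axis. -/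
noncomputable def restrictAxis (k : Type*) [Field k] :
    MvPolynomial (Fin 3) k →ₐ[k] Polynomial k :=
  aeval ![Polynomial.X, 0, 0]

theorem derivative_restrictAxis {k : Type*} [Field k] (f : MvPolynomial (Fin 3) k) :
    (restrictAxis k f).derivative = restrictAxis k (pderiv 0 f) := by
  have h := derivation_aeval_eq_sum (Polynomial.derivative' (R := k))
    ![Polynomial.X, 0, 0] f
  simpa [Fin.sum_univ_three, restrictAxis] using h

theorem IsPolyAut.exists_affine {k : Type*} [Field k] [CharZero k]
    {T : Fin 3 → MvPolynomial (Fin 3) k} (hT : IsPolyAut T)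
    (h1 : pderiv 1 (T 0) = 0) (h2 : pderiv 2 (T 0) = 0) :
    ∃ a b : k, a ≠ 0 ∧
      restrictAxis k (T 0) = Polynomial.C a * Polynomial.X + Polynomial.C b := by
  have hu := hT.isUnit_det_jacobianMatrix
  have hdvd : pderiv 0 (T 0) ∣ (jacobianMatrix T).det := by
    refine ⟨pderiv 1 (T 1) * pderiv 2 (T 2) - pderiv 2 (T 1) * pderiv 1 (T 2), ?_⟩
    simp only [jacobianMatrix, Matrix.det_fin_three, Matrix.of_apply, h1, h2]
    ring
  have hu' := (isUnit_of_dvd_unit hdvd hu).map (restrictAxis k)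
  rw [← derivative_restrictAxis] at hu'
  obtain ⟨a, ha, hder⟩ := Polynomial.isUnit_iff.1 hu'
  have : (restrictAxis k (T 0)).derivative = (Polynomial.C a * Polynomial.X).derivative := by
    rw [← hder, Polynomial.derivative_C_mul, Polynomial.derivative_X, mul_one]
  obtain ⟨b, hb⟩ := exists_eq_add_C_of_derivative_eq this
  exact ⟨a, b, ha.ne_zero, hb⟩

/-- If `p` is non-constant and `p (T 0)` only depends on the first variable, then so does `T 0`. -/
theorem IsPolyAut.pderiv_eq_zero {k : Type*} [Field k] [CharZero k]
    {T : Fin 3 → MvPolynomial (Fin 3) k} (hT : IsPolyAut T) {p : Polynomial k}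
    (hp : p.derivative ≠ 0) {j : Fin 3} (h : pderiv j (Polynomial.aeval (T 0) p) = 0) :
    pderiv j (T 0) = 0 := by
  rw [Derivation.map_aeval, smul_eq_mul] at h
  refine (mul_eq_zero.1 h).resolve_left fun h0 => hp ?_
  have h0' : aeval T (Polynomial.aeval (X 0 : MvPolynomial (Fin 3) k) p.derivative) = 0 := by
    rw [← Polynomial.aeval_algHom_apply, aeval_X, h0]
  have h1 := (map_eq_zero_iff _ hT.aeval_injective).1 h0'
  have h2 := congrArg (restrictAxis k) h1
  rw [← Polynomial.aeval_algHom_apply] at h2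
  simpa [restrictAxis] using h2

theorem equivalent_univariate_char_zero
    {k : Type*} [Field k] [CharZero k] (P Q : Polynomial k)
    (F G : Fin 3 → MvPolynomial (Fin 3) k)
    (hF : F = ![Polynomial.aeval (X 0 : MvPolynomial (Fin 3) k) P, X 1, X 2])
    (hG : G = ![Polynomial.aeval (X 0 : MvPolynomial (Fin 3) k) Q, X 1, X 2])
    (hequiv : ∃ S T : Fin 3 → MvPolynomial (Fin 3) k,
      IsPolyAut S ∧ IsPolyAut T ∧ endoComp S F = endoComp G T) :
    ∃ a b c d : k, a ≠ 0 ∧ c ≠ 0 ∧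
      Q.comp (Polynomial.C a * Polynomial.X + Polynomial.C b) =
        Polynomial.C c * P + Polynomial.C d := by
  obtain ⟨S, T, hS, hT, hST⟩ := hequiv
  have hdet := congrArg (fun H => (jacobianMatrix H).det) hST
  simp only [det_jacobianMatrix_endoComp] at hdet
  rw [hF, hG, det_jacobianMatrix_polynomial, det_jacobianMatrix_polynomial,
    ← Polynomial.aeval_algHom_apply, aeval_X] at hdet
  obtain ⟨s, hs, hsdet⟩ := MvPolynomial.isUnit_iff_eq_C_of_isReduced.1
    hS.isUnit_det_jacobianMatrix
  obtain ⟨t, ht, htdet⟩ := MvPolynomial.isUnit_iff_eq_C_of_isReduced.1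
    hT.isUnit_det_jacobianMatrix
  have hs0 := hs.ne_zero
  have ht0 := ht.ne_zero
  rw [hsdet, htdet, aeval_C, MvPolynomial.algebraMap_eq] at hdet
  have key : Polynomial.aeval (T 0) Q.derivative =
      Polynomial.aeval (X 0) (Polynomial.C (s / t) * P.derivative) := by
    rw [map_mul, Polynomial.aeval_C, MvPolynomial.algebraMap_eq, div_eq_inv_mul, C_mul, mul_assoc,
      hdet, mul_left_comm, ← C_mul, inv_mul_cancel₀ ht0, C_1, mul_one]
  have hres : Q.derivative.comp (restrictAxis k (T 0)) =
      Polynomial.C (s / t) * P.derivative := by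
    have h := congrArg (restrictAxis k) key
    rw [← Polynomial.aeval_algHom_apply, ← Polynomial.aeval_algHom_apply] at h
    simpa [restrictAxis, Polynomial.comp, Polynomial.aeval_def] using h
  obtain ⟨a, b, ha, hab⟩ : ∃ a b : k, a ≠ 0 ∧
      Q.derivative.comp (Polynomial.C a * Polynomial.X + Polynomial.C b) =
        Polynomial.C (s / t) * P.derivative := by
    by_cases hQ : Q.derivative.derivative = 0
    · obtain ⟨q, hq⟩ := Polynomial.natDegree_eq_zero.1
        (Polynomial.derivative_eq_zero.1 hQ)
      refine ⟨1, 0, one_ne_zero, ?_⟩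
      rw [← hres, ← hq, Polynomial.C_comp, Polynomial.C_comp]
    · have hj (j : Fin 3) (hj0 : j ≠ 0) : pderiv j (T 0) = 0 := by
        refine hT.pderiv_eq_zero hQ ?_
        rw [key, Derivation.map_aeval, pderiv_X_of_ne hj0.symm, smul_zero]
      obtain ⟨a, b, ha, hab⟩ := hT.exists_affine (hj 1 (by decide)) (hj 2 (by decide))
      exact ⟨a, b, ha, hab ▸ hres⟩
  have hder : (Q.comp (Polynomial.C a * Polynomial.X + Polynomial.C b)).derivative =
      (Polynomial.C (a * (s / t)) * P).derivative := by
    rw [Polynomial.derivative_comp, hab]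
    simp [mul_assoc]
  obtain ⟨d, hd⟩ := exists_eq_add_C_of_derivative_eq hder
  exact ⟨a, b, a * (s / t), d, ha, mul_ne_zero ha (div_ne_zero hs0 ht0), hd⟩
end
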